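/- arXiv:2012.02335 — 3 statements merged into one kernel-verified Lean document; each statement's English description precedes it below -/
import Mathlib

section
/- There exists a universal constant C > 0 such that for every positive integer n, every Boolean function f : {-1,1}^n → {-1,1} with k(f) > 1, and every set 𝒮 ⊆ supp(f) that is a basis of span_{F₂}(supp(f)), one has Σ_{S∈𝒮} |f̂(S)| ≤ C · δ(f) · deg₂(f), and consequently Σ_{S∈𝒮} |f̂(S)| ≤ C · δ(f) · log k(f). -/
open scoped BigOperators
open scoped Classical

noncomputable section

namespace BoolFunc

/-- Real value of a hypercube coordinate: `true ↦ -1`, `false ↦ 1`. -/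
def signv (b : Bool) : ℝ := if b then -1 else 1

/-- Fourier coefficient `f̂(S)` of `f : {-1,1}ⁿ → ℝ`. -/
def fourierCoeff {n : ℕ} (f : (Fin n → Bool) → ℝ) (S : Finset (Fin n)) : ℝ :=
  (∑ x : Fin n → Bool, f x * ∏ i ∈ S, signv (x i)) / 2 ^ n

/-- Fourier support of `f`. -/
def fourierSupport {n : ℕ} (f : (Fin n → Bool) → ℝ) : Finset (Finset (Fin n)) :=
  Finset.univ.filter (fun S => fourierCoeff f S ≠ 0)

/-- Fourier sparsity `k(f)`. -/
def sparsity {n : ℕ} (f : (Fin n → Bool) → ℝ) : ℕ := (fourierSupport f).card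

/-- Indicator vector in `F₂ⁿ` of a subset of `[n]`. -/
def indicatorVec {n : ℕ} (S : Finset (Fin n)) : Fin n → ZMod 2 :=
  fun i => if i ∈ S then 1 else 0

/-- Fourier rank `r(f)`: the `F₂`-dimension of the span of the Fourier support. -/
def fourierRank {n : ℕ} (f : (Fin n → Bool) → ℝ) : ℕ :=
  Module.finrank (ZMod 2)
    ↥(Submodule.span (ZMod 2)
      (indicatorVec '' (fourierSupport f : Set (Finset (Fin n)))))

/-- Weight `δ(f) = Pr[f(x) = -1]`. -/
def weight {n : ℕ} (f : (Fin n → Bool) → ℝ) : ℝ :=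
  ((Finset.univ.filter (fun x : Fin n → Bool => f x = -1)).card : ℝ) / 2 ^ n

/-- Fourier max-supp-entropy `k'(f) = max_{S ∈ supp(f)} 1/|f̂(S)|`. -/
def maxSuppEntropy {n : ℕ} (f : (Fin n → Bool) → ℝ) : ℝ :=
  sSup ((fun S => 1 / |fourierCoeff f S|) '' (fourierSupport f : Set (Finset (Fin n))))

/-- Dimension of the span of `{S : |f̂(S)| ≥ 1/t}`. -/
def levelDim {n : ℕ} (f : (Fin n → Bool) → ℝ) (t : ℝ) : ℕ :=
  Module.finrank (ZMod 2)
    ↥(Submodule.span (ZMod 2)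
      (indicatorVec '' {S : Finset (Fin n) | 1 / t ≤ |fourierCoeff f S|}))

/-- Fourier max-rank-entropy `k''(f)`. -/
def maxRankEntropy {n : ℕ} (f : (Fin n → Bool) → ℝ) : ℝ :=
  sInf {t : ℝ | 0 < t ∧ levelDim f t = fourierRank f}

/-- `f` is Boolean-valued (takes values in `{-1,1}`). -/
def IsBooleanFunc {n : ℕ} (f : (Fin n → Bool) → ℝ) : Prop := ∀ x, f x = 1 ∨ f x = -1

/-- Coefficient of the monomial `∏_{i ∈ S} zᵢ` in the unique multilinear `F₂`-polynomial
representing `f` under the identification `-1 ↦ 1, 1 ↦ 0` of `{-1,1}` with `F₂`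
(a coordinate `xᵢ = true` stands for `-1`, i.e. for the bit `1`). -/
def f2Coeff {n : ℕ} (f : (Fin n → Bool) → ℝ) (S : Finset (Fin n)) : ZMod 2 :=
  ∑ x ∈ Finset.univ.filter (fun x : Fin n → Bool => ∀ i, x i = true → i ∈ S),
    (if f x = -1 then 1 else 0)

/-- The `F₂`-degree `deg₂(f)`. -/
def f2Degree {n : ℕ} (f : (Fin n → Bool) → ℝ) : ℕ :=
  (Finset.univ.filter (fun S : Finset (Fin n) => f2Coeff f S ≠ 0)).sup Finset.card

/-! ### Points and characters over `F₂` -/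

/-- The vector of bits of a point of the hypercube. -/
def bits {n : ℕ} (x : Fin n → Bool) : Fin n → ZMod 2 := fun i => if x i then 1 else 0

lemma bits_bijective {n : ℕ} : Function.Bijective (bits (n := n)) := by
  refine ⟨fun x y h => ?_, fun z => ⟨fun i => decide (z i = 1), ?_⟩⟩
  · funext i
    have hi := congrFun h i
    unfold bits at hi
    revert hi
    cases x i <;> cases y i <;> simp
  · funext i
    unfold bits
    have h : ∀ a : ZMod 2, (if decide (a = 1) = true then (1 : ZMod 2) else 0) = a := by decide
    exact h (z i)

/-- The nontrivial additive character of `F₂`. -/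
def zsign (a : ZMod 2) : ℝ := if a = 0 then 1 else -1

lemma zsign_add (a b : ZMod 2) : zsign (a + b) = zsign a * zsign b := by
  have h : ∀ c : ZMod 2, c = 0 ∨ c = 1 := by decide
  have h2 : (1 : ZMod 2) + 1 = 0 := by decide
  rcases h a with rfl | rfl <;> rcases h b with rfl | rfl <;> simp [zsign, h2]

lemma zsign_sum {ι : Type*} (s : Finset ι) (g : ι → ZMod 2) :
    zsign (∑ i ∈ s, g i) = ∏ i ∈ s, zsign (g i) := by
  induction s using Finset.induction_on with
  | empty => simp [zsign]
  | insert i s hi ih => rw [Finset.sum_insert hi, Finset.prod_insert hi, zsign_add, ih]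

lemma prod_signv_eq_zsign {n : ℕ} (T : Finset (Fin n)) (x : Fin n → Bool) :
    ∏ i ∈ T, signv (x i) = zsign (indicatorVec T ⬝ᵥ bits x) := by
  unfold dotProduct
  rw [zsign_sum, ← Finset.prod_subset (Finset.subset_univ T)]
  · refine Finset.prod_congr rfl fun i hi => ?_
    cases h : x i <;> simp [indicatorVec, bits, signv, zsign, hi, h]
  · intro i _ hi
    simp [indicatorVec, hi, zsign]

lemma sum_prod_signv_eq_zero {n : ℕ} {T : Finset (Fin n)} (hT : T.Nonempty) :
    ∑ x : Fin n → Bool, ∏ i ∈ T, signv (x i) = 0 := by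
  obtain ⟨j, hj⟩ := hT
  let g : Fin n → Bool → ℝ := fun i b => if i ∈ T then signv b else 1
  have h : ∀ x : Fin n → Bool, ∏ i ∈ T, signv (x i) =
      ∏ i, g i (x i) := by
    intro x
    simp [g]
  rw [Finset.sum_congr rfl fun x _ => h x, ← Fintype.prod_sum g]
  exact Finset.prod_eq_zero (Finset.mem_univ j) (by simp [g, hj, signv])

/-! ### The `F₂`-polynomial of a Boolean function -/

/-- The set on which `f` takes the value `-1`. -/
def negSet {n : ℕ} (f : (Fin n → Bool) → ℝ) : Finset (Fin n → Bool) :=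
  Finset.univ.filter (fun x => f x = -1)

/-- The multilinear polynomial over `F₂` representing `f`. -/
def f2Poly {n : ℕ} (f : (Fin n → Bool) → ℝ) : MvPolynomial (Fin n) (ZMod 2) :=
  ∑ S : Finset (Fin n), MvPolynomial.C (f2Coeff f S) * ∏ i ∈ S, MvPolynomial.X i

lemma totalDegree_f2Poly_le {n : ℕ} (f : (Fin n → Bool) → ℝ) :
    (f2Poly f).totalDegree ≤ f2Degree f := by
  refine MvPolynomial.totalDegree_finsetSum_le fun S _ => ?_
  by_cases hS : f2Coeff f S = 0
  · simp [hS]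
  · refine (MvPolynomial.totalDegree_mul _ _).trans ?_
    rw [MvPolynomial.totalDegree_C, zero_add]
    refine (MvPolynomial.totalDegree_finsetProd _ _).trans ?_
    simp only [MvPolynomial.totalDegree_X, Finset.sum_const, smul_eq_mul, mul_one]
    exact Finset.le_sup (f := Finset.card) (by simpa using hS)

lemma eval_f2Poly {n : ℕ} (f : (Fin n → Bool) → ℝ) (x : Fin n → Bool) :
    MvPolynomial.eval (bits x) (f2Poly f) = if f x = -1 then 1 else 0 := by
  let supp : (Fin n → Bool) → Finset (Fin n) := fun y => Finset.univ.filter (fun i => y i = true)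
  have hprod : ∀ S : Finset (Fin n),
      ∏ i ∈ S, bits x i = if S ⊆ supp x then 1 else 0 := by
    intro S
    unfold bits
    rw [Finset.prod_ite_zero]
    simp [supp, Finset.subset_iff]
  have hcoeff : ∀ S : Finset (Fin n), f2Coeff f S =
      ∑ y, if supp y ⊆ S then (if f y = -1 then (1 : ZMod 2) else 0) else 0 := by
    intro S
    unfold f2Coeff
    rw [Finset.sum_filter]
    simp [supp, Finset.subset_iff]
  have hcount : ∀ y : Fin n → Bool,
      (∑ S : Finset (Fin n), if supp y ⊆ S ∧ S ⊆ supp x then (1 : ZMod 2) else 0) =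
        if y = x then 1 else 0 := by
    intro y
    have hI : Finset.univ.filter (fun S => supp y ⊆ S ∧ S ⊆ supp x) =
        Finset.Icc (supp y) (supp x) := by
      ext S
      simp
    rw [Finset.sum_boole, hI]
    by_cases hyx : y = x
    · simp [hyx]
    · rw [if_neg hyx]
      have hne : supp y ≠ supp x := by
        intro h
        refine hyx (funext fun i => ?_)
        have hi : i ∈ supp y ↔ i ∈ supp x := by rw [h]
        simp only [supp, Finset.mem_filter, Finset.mem_univ, true_and] at hi
        exact Bool.eq_iff_iff.2 hi
      by_cases hs : supp y ⊆ supp x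
      · have hlt := Finset.card_lt_card (hs.ssubset_of_ne hne)
        have h2 : (2 : ZMod 2) = 0 := by decide
        rw [Finset.card_Icc_finset hs, Nat.cast_pow, Nat.cast_ofNat, h2,
          zero_pow (by omega)]
      · rw [Finset.Icc_eq_empty (by simpa using hs)]
        simp
  calc MvPolynomial.eval (bits x) (f2Poly f)
      = ∑ S : Finset (Fin n), ∑ y, (if f y = -1 then (1 : ZMod 2) else 0) *
          (if supp y ⊆ S ∧ S ⊆ supp x then 1 else 0) := by
        simp only [f2Poly, map_sum, map_mul, map_prod, MvPolynomial.eval_C, MvPolynomial.eval_X,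
          hprod]
        refine Finset.sum_congr rfl fun S _ => ?_
        rw [hcoeff, Finset.sum_mul]
        refine Finset.sum_congr rfl fun y _ => ?_
        by_cases h1 : supp y ⊆ S <;> by_cases h2 : S ⊆ supp x <;> simp [h1, h2]
    _ = ∑ y, (if f y = -1 then (1 : ZMod 2) else 0) * (if y = x then 1 else 0) := by
        rw [Finset.sum_comm]
        refine Finset.sum_congr rfl fun y _ => ?_
        rw [← Finset.mul_sum, hcount]
    _ = if f x = -1 then 1 else 0 := by simp

/-- A polynomial of degree less than `n - deg₂(f)` sums to zero over `f⁻¹(-1)`. -/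
lemma sum_negSet_eval_eq_zero {n : ℕ} (f : (Fin n → Bool) → ℝ)
    (q : MvPolynomial (Fin n) (ZMod 2)) (hq : q.totalDegree + f2Degree f < n) :
    ∑ x ∈ negSet f, MvPolynomial.eval (bits x) q = 0 := by
  have hdeg : (f2Poly f * q).totalDegree < (Fintype.card (ZMod 2) - 1) * Fintype.card (Fin n) := by
    have h1 := MvPolynomial.totalDegree_mul (f2Poly f) q
    have h2 := totalDegree_f2Poly_le f
    rw [ZMod.card, Fintype.card_fin]
    omega
  have h := MvPolynomial.sum_eval_eq_zero _ hdeg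
  rw [← (bits_bijective (n := n)).sum_comp fun z => MvPolynomial.eval z (f2Poly f * q)] at h
  rw [← h, negSet, Finset.sum_filter]
  refine Finset.sum_congr rfl fun x _ => ?_
  rw [map_mul, eval_f2Poly]
  split_ifs <;> simp

/-- The affine form `z ↦ ∑ vᵢ zᵢ + c`. -/
def affineForm {n : ℕ} (v : Fin n → ZMod 2) (c : ZMod 2) : MvPolynomial (Fin n) (ZMod 2) :=
  ∑ i, MvPolynomial.C (v i) * MvPolynomial.X i + MvPolynomial.C c

lemma totalDegree_affineForm_le {n : ℕ} (v : Fin n → ZMod 2) (c : ZMod 2) :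
    (affineForm v c).totalDegree ≤ 1 := by
  refine (MvPolynomial.totalDegree_add _ _).trans (max_le ?_ (by simp))
  refine MvPolynomial.totalDegree_finsetSum_le fun i _ => ?_
  refine (MvPolynomial.totalDegree_mul _ _).trans ?_
  simp

lemma eval_affineForm {n : ℕ} (v : Fin n → ZMod 2) (c : ZMod 2) (z : Fin n → ZMod 2) :
    MvPolynomial.eval z (affineForm v c) = v ⬝ᵥ z + c := by
  simp [affineForm, dotProduct]

/-! ### Counting by a dimension argument -/

section Levels

variable {X κ : Type*} [Fintype κ]

/-- The number of nonzero coordinates of `L x`. -/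
def level (L : X → κ → ZMod 2) (x : X) : ℕ := (Finset.univ.filter (fun k => L x k ≠ 0)).card

/-- The monomials indexed by the supports of points of level at most `a`, evaluated on `A`. -/
def levelMatrix (A : Finset X) (L : X → κ → ZMod 2) (a : ℕ) :
    Matrix (A.filter (fun x => level L x ≤ a)) A (ZMod 2) :=
  fun y x => ∏ k ∈ Finset.univ.filter (fun k => L y.1 k ≠ 0), L x.1 k

lemma rank_levelMatrix (A : Finset X) (L : X → κ → ZMod 2) (hL : Function.Injective L) (a : ℕ) :
    (levelMatrix A L a).rank = (A.filter (fun x => level L x ≤ a)).card := by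
  have hone : ∀ c : ZMod 2, c ≠ 0 → c = 1 := by decide
  rw [← Fintype.card_coe]
  refine LinearIndependent.rank_matrix ?_
  rw [Fintype.linearIndependent_iff]
  intro g hg
  by_contra! hne
  obtain ⟨y₀, hy₀⟩ := hne
  obtain ⟨y, hy, hmin⟩ := Finset.exists_min_image
    (Finset.univ.filter (fun y => g y ≠ 0)) (fun y => level L y.1) ⟨y₀, by simpa using hy₀⟩
  have hgy : g y ≠ 0 := by simpa using hy
  have heval := congrFun hg ⟨y.1, (Finset.mem_filter.1 y.2).1⟩
  rw [Finset.sum_apply, Finset.sum_eq_single y] at heval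
  · have h1 : levelMatrix A L a y ⟨y.1, (Finset.mem_filter.1 y.2).1⟩ = 1 :=
      Finset.prod_eq_one fun k hk => hone _ (by simpa using hk)
    simp only [Pi.smul_apply, Matrix.row, smul_eq_mul, h1, mul_one, Pi.zero_apply] at heval
    exact hgy heval
  · intro z _ hzy
    by_cases hgz : g z = 0
    · simp [hgz]
    have hle : level L y.1 ≤ level L z.1 := hmin z (by simpa using hgz)
    suffices h0 : levelMatrix A L a z ⟨y.1, (Finset.mem_filter.1 y.2).1⟩ = 0 by
      simp [Matrix.row, h0]
    by_contra hprod
    have hsub : Finset.univ.filter (fun k => L z.1 k ≠ 0) ⊆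
        Finset.univ.filter (fun k => L y.1 k ≠ 0) := by
      intro k hk
      simpa using Finset.prod_ne_zero_iff.1 hprod k hk
    have heq := Finset.eq_of_subset_of_card_le hsub hle
    refine hzy (Subtype.ext (hL (funext fun k => ?_)))
    have hk : L z.1 k ≠ 0 ↔ L y.1 k ≠ 0 := by simpa using Finset.ext_iff.1 heq k
    by_cases hz : L z.1 k = 0
    · rw [hz, not_not.1 (mt hk.2 (not_not.2 hz))]
    · rw [hone _ hz, hone _ (hk.1 hz)]
  · simp

lemma card_level_add_card_level_le (A : Finset X) (L : X → κ → ZMod 2)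
    (hL : Function.Injective L) {m : ℕ}
    (horth : ∀ P Q : Finset κ, P.card + Q.card < m →
      ∑ x ∈ A, (∏ k ∈ P, L x k) * ∏ k ∈ Q, L x k = 0)
    {a b : ℕ} (hab : a + b < m) :
    (A.filter (fun x => level L x ≤ a)).card + (A.filter (fun x => level L x ≤ b)).card ≤
      A.card := by
  have hmul : levelMatrix A L a * (levelMatrix A L b).transpose = 0 := by
    ext y z
    rw [Matrix.mul_apply, Matrix.zero_apply]
    simp only [levelMatrix, Matrix.transpose_apply]
    have hy := (Finset.mem_filter.1 y.2).2
    have hz := (Finset.mem_filter.1 z.2).2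
    unfold level at hy hz
    exact (Finset.sum_coe_sort A _).trans (horth _ _ (lt_of_le_of_lt (add_le_add hy hz) hab))
  have h := Matrix.rank_add_rank_le_card_of_mul_eq_zero hmul
  rwa [Matrix.rank_transpose, rank_levelMatrix A L hL, rank_levelMatrix A L hL,
    Fintype.card_coe] at h

lemma sum_level_ge (A : Finset X) (L : X → κ → ZMod 2) (hL : Function.Injective L) {m : ℕ}
    (horth : ∀ P Q : Finset κ, P.card + Q.card < m →
      ∑ x ∈ A, (∏ k ∈ P, L x k) * ∏ k ∈ Q, L x k = 0) :
    A.card * m ≤ 2 * ∑ x ∈ A, level L x := by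
  set N : ℕ → ℕ := fun a => (A.filter (fun x => level L x ≤ a)).card with hN
  have hpair : 2 * ∑ a ∈ Finset.range m, N a ≤ m * A.card := by
    calc 2 * ∑ a ∈ Finset.range m, N a
        = ∑ a ∈ Finset.range m, (N a + N (m - 1 - a)) := by
          rw [Finset.sum_add_distrib, Finset.sum_range_reflect, two_mul]
      _ ≤ ∑ _a ∈ Finset.range m, A.card := by
          refine Finset.sum_le_sum fun a ha => ?_
          have := Finset.mem_range.1 ha
          exact card_level_add_card_level_le A L hL horth (by omega)
      _ = m * A.card := by simp
  have hswap : ∑ a ∈ Finset.range m, N a = ∑ x ∈ A, (m - level L x) := by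
    simp only [hN, Finset.card_filter]
    rw [Finset.sum_comm]
    refine Finset.sum_congr rfl fun x _ => ?_
    rw [← Finset.card_filter, ← Nat.card_Ico]
    congr 1
    ext a
    simp [and_comm]
  have hlow : A.card * m ≤ ∑ x ∈ A, (m - level L x) + ∑ x ∈ A, level L x := by
    rw [← Finset.sum_add_distrib, ← smul_eq_mul, ← Finset.sum_const]
    exact Finset.sum_le_sum fun x _ => by omega
  rw [hswap] at hpair
  nlinarith

end Levels

/-! ### The level-one inequality in an arbitrary basis -/

lemma injective_affine {n : ℕ} {κ : Type*} [Fintype κ] (v : κ → Fin n → ZMod 2)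
    (hv : Submodule.span (ZMod 2) (Set.range v) = ⊤) (c : κ → ZMod 2) :
    Function.Injective (fun (x : Fin n → Bool) k => v k ⬝ᵥ bits x + c k) := by
  intro x y hxy
  refine bits_bijective.1 (sub_eq_zero.1 (dotProduct_eq_zero _ fun w => ?_))
  rw [dotProduct_comm]
  have hw : w ∈ Submodule.span (ZMod 2) (Set.range v) := hv ▸ Submodule.mem_top
  induction hw using Submodule.span_induction with
  | mem u hu =>
    obtain ⟨k, rfl⟩ := hu
    have := congrFun hxy k
    simp only [add_left_inj] at this
    rw [dotProduct_sub, this, sub_self]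
  | zero => simp
  | add a b _ _ ha hb => rw [add_dotProduct, ha, hb, add_zero]
  | smul r a _ ha => rw [smul_dotProduct, ha, smul_zero]

lemma sum_abs_sum_negSet_le {n : ℕ} {κ : Type*} [Fintype κ] (f : (Fin n → Bool) → ℝ)
    (v : κ → Fin n → ZMod 2) (hv : Submodule.span (ZMod 2) (Set.range v) = ⊤)
    (hcard : Fintype.card κ = n) :
    ∑ k, |∑ x ∈ negSet f, zsign (v k ⬝ᵥ bits x)| ≤ (negSet f).card * f2Degree f := by
  let c : κ → ZMod 2 := fun k => if 0 ≤ ∑ x ∈ negSet f, zsign (v k ⬝ᵥ bits x) then 0 else 1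
  let L : (Fin n → Bool) → κ → ZMod 2 := fun x k => v k ⬝ᵥ bits x + c k
  have hdeg : ∀ P : Finset κ, (∏ k ∈ P, affineForm (v k) (c k)).totalDegree ≤ P.card := fun P => by
    refine (MvPolynomial.totalDegree_finsetProd _ _).trans ?_
    exact (Finset.sum_le_sum fun k _ => totalDegree_affineForm_le (v k) (c k)).trans (by simp)
  have hge : (negSet f).card * (n - f2Degree f) ≤ 2 * ∑ x ∈ negSet f, level L x := by
    refine sum_level_ge (negSet f) L (injective_affine v hv c) fun P Q hPQ => ?_
    rw [← sum_negSet_eval_eq_zero f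
      ((∏ k ∈ P, affineForm (v k) (c k)) * ∏ k ∈ Q, affineForm (v k) (c k))]
    · simp only [map_mul, map_prod, eval_affineForm, L]
    · have h1 := MvPolynomial.totalDegree_mul (∏ k ∈ P, affineForm (v k) (c k))
        (∏ k ∈ Q, affineForm (v k) (c k))
      have := hdeg P
      have := hdeg Q
      omega
  have hlevel : ∀ x, ∑ k, zsign (L x k) = n - 2 * (level L x : ℝ) := by
    intro x
    have h : ∀ k, zsign (L x k) = 1 - 2 * (if L x k ≠ 0 then 1 else 0) := by
      intro k
      by_cases hk : L x k = 0 <;> simp [zsign, hk]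
      norm_num
    simp_rw [h]
    rw [Finset.sum_sub_distrib, ← Finset.mul_sum, Finset.sum_boole]
    simp [level, hcard]
  have habs : ∀ k, |∑ x ∈ negSet f, zsign (v k ⬝ᵥ bits x)| = ∑ x ∈ negSet f, zsign (L x k) := by
    intro k
    simp only [L, zsign_add, ← Finset.sum_mul]
    by_cases hk : 0 ≤ ∑ x ∈ negSet f, zsign (v k ⬝ᵥ bits x)
    · have hc : c k = 0 := if_pos hk
      rw [abs_of_nonneg hk, hc, zsign, if_pos rfl, mul_one]
    · have hc : c k = 1 := if_neg hk
      rw [abs_of_neg (not_le.1 hk), hc, zsign, if_neg one_ne_zero, mul_neg_one]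
  simp_rw [habs]
  rw [Finset.sum_comm]
  simp_rw [hlevel]
  rw [Finset.sum_sub_distrib, ← Finset.mul_sum, Finset.sum_const, nsmul_eq_mul]
  have hnd : (n : ℝ) ≤ ((n - f2Degree f : ℕ) : ℝ) + f2Degree f := by
    exact_mod_cast (by omega : n ≤ n - f2Degree f + f2Degree f)
  have hge' : ((negSet f).card : ℝ) * ((n - f2Degree f : ℕ) : ℝ) ≤
      2 * ∑ x ∈ negSet f, (level L x : ℝ) := by exact_mod_cast hge
  have := mul_le_mul_of_nonneg_left hnd (Nat.cast_nonneg (α := ℝ) (negSet f).card)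
  linarith

lemma eq_one_sub_ite {n : ℕ} {f : (Fin n → Bool) → ℝ} (hf : IsBooleanFunc f) (x : Fin n → Bool) :
    f x = 1 - 2 * (if f x = -1 then 1 else 0) := by
  rcases hf x with h | h <;> rw [h] <;> norm_num

lemma fourierCoeff_eq_of_nonempty {n : ℕ} {f : (Fin n → Bool) → ℝ} (hf : IsBooleanFunc f)
    {T : Finset (Fin n)} (hT : T.Nonempty) :
    fourierCoeff f T = -2 * (∑ x ∈ negSet f, zsign (indicatorVec T ⬝ᵥ bits x)) / 2 ^ n := by
  have h : ∀ x, f x * ∏ i ∈ T, signv (x i) = ∏ i ∈ T, signv (x i) -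
      2 * (if f x = -1 then ∏ i ∈ T, signv (x i) else 0) := by
    intro x
    conv_lhs => rw [eq_one_sub_ite hf x]
    split_ifs <;> ring
  unfold fourierCoeff
  simp_rw [h]
  rw [Finset.sum_sub_distrib, sum_prod_signv_eq_zero hT, ← Finset.mul_sum, ← Finset.sum_filter]
  simp_rw [prod_signv_eq_zsign]
  rw [negSet]
  ring

lemma sum_abs_fourierCoeff_le {n : ℕ} {f : (Fin n → Bool) → ℝ} (hf : IsBooleanFunc f)
    (𝒮 : Finset (Finset (Fin n)))
    (hli : LinearIndepOn (ZMod 2) indicatorVec (𝒮 : Set (Finset (Fin n)))) :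
    ∑ S ∈ 𝒮, |fourierCoeff f S| ≤ 2 * weight f * f2Degree f := by
  obtain ⟨b, -, hsub, hspan, hb⟩ := exists_linearIndepOn_extension hli (Set.subset_univ _)
  have hrange : Submodule.span (ZMod 2) (Set.range fun T : b => indicatorVec T.1) = ⊤ := by
    rw [← Set.image_eq_range, eq_top_iff]
    intro w _
    refine hspan ⟨Finset.univ.filter (fun i => w i ≠ 0), Set.mem_univ _, ?_⟩
    funext i
    have hone : ∀ c : ZMod 2, c ≠ 0 → c = 1 := by decide
    by_cases hi : w i = 0
    · simp [indicatorVec, hi]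
    · simp [indicatorVec, hone _ hi]
  have hcard : Fintype.card b = n := by
    have h := Module.finrank_eq_card_basis (Module.Basis.mk hb hrange.ge)
    rw [← h, Module.finrank_fin_fun]
  have hne : ∀ T ∈ b, T.Nonempty := by
    intro T hT
    rw [Finset.nonempty_iff_ne_empty]
    rintro rfl
    exact hb.ne_zero hT (by funext i; simp [indicatorVec])
  calc ∑ S ∈ 𝒮, |fourierCoeff f S|
      ≤ ∑ S ∈ b.toFinset, |fourierCoeff f S| :=
        Finset.sum_le_sum_of_subset_of_nonneg (fun S hS => by simpa using hsub hS)
          fun _ _ _ => abs_nonneg _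
    _ = ∑ T : b, |fourierCoeff f T.1| := Finset.sum_subtype _ (by simp) _
    _ = ∑ T : b, 2 / 2 ^ n * |∑ x ∈ negSet f, zsign (indicatorVec T.1 ⬝ᵥ bits x)| := by
        refine Finset.sum_congr rfl fun T _ => ?_
        rw [fourierCoeff_eq_of_nonempty hf (hne T.1 T.2), abs_div, abs_mul]
        simp only [abs_neg, abs_pow, Nat.abs_ofNat]
        ring
    _ ≤ 2 / 2 ^ n * ((negSet f).card * f2Degree f) := by
        rw [← Finset.mul_sum]
        exact mul_le_mul_of_nonneg_left (sum_abs_sum_negSet_le f _ hrange hcard) (by positivity)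
    _ = 2 * weight f * f2Degree f := by
        rw [weight, negSet]
        ring

/-! ### The `F₂`-degree is at most the logarithm of the sparsity -/

/-- Summing the Fourier coefficients over a coset gives a Fourier coefficient of a restriction. -/
lemma sum_fourierCoeff_union {n : ℕ} (f : (Fin n → Bool) → ℝ) {S T : Finset (Fin n)}
    (hT : T ⊆ S) :
    ∑ W ∈ Sᶜ.powerset, fourierCoeff f (T ∪ W) =
      (∑ x ∈ Finset.univ.filter (fun x : Fin n → Bool => ∀ i, x i = true → i ∈ S),
        f x * ∏ i ∈ T, signv (x i)) * 2 ^ Sᶜ.card / 2 ^ n := by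
  unfold fourierCoeff
  rw [← Finset.sum_div, Finset.sum_comm, Finset.sum_filter, Finset.sum_mul]
  congr 1
  refine Finset.sum_congr rfl fun x _ => ?_
  have hsplit : ∀ W ∈ Sᶜ.powerset, f x * ∏ i ∈ T ∪ W, signv (x i) =
      f x * (∏ i ∈ T, signv (x i)) * ∏ i ∈ W, signv (x i) := by
    intro W hW
    rw [Finset.prod_union, mul_assoc]
    exact Finset.disjoint_of_subset_left hT
      (Finset.disjoint_of_subset_right (Finset.mem_powerset.1 hW) disjoint_compl_right)
  rw [Finset.sum_congr rfl hsplit, ← Finset.mul_sum, ← Finset.prod_one_add]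
  split_ifs with h
  · congr 1
    refine Finset.prod_eq_pow_card fun i hi => ?_
    have hx : x i = false := by
      by_contra hx
      exact Finset.mem_compl.1 hi (h i (by simpa using hx))
    rw [hx]
    norm_num [signv]
  · push Not at h
    obtain ⟨i, hi, hiS⟩ := h
    rw [Finset.prod_eq_zero (Finset.mem_compl.2 hiS) (by simp [hi, signv]), mul_zero, zero_mul]

lemma exists_odd_sum_signs {ι : Type*} (A : Finset ι) (hA : Odd A.card) (g : ι → ℝ)
    (hg : ∀ x, g x = 1 ∨ g x = -1) : ∃ z : ℤ, Odd z ∧ ∑ x ∈ A, g x = z := by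
  refine ⟨A.card - 2 * (A.filter (fun x => g x = -1)).card, ?_, ?_⟩
  · have h1 : Odd (A.card : ℤ) := by exact_mod_cast hA
    exact h1.sub_even (even_two_mul _)
  · have h : ∀ x, g x = 1 - 2 * (if g x = -1 then 1 else 0) := by
      intro x
      rcases hg x with h | h <;> rw [h] <;> norm_num
    rw [Finset.sum_congr rfl fun x _ => h x, Finset.sum_sub_distrib, ← Finset.mul_sum,
      Finset.sum_boole]
    simp

lemma prod_signv_eq_or {n : ℕ} (T : Finset (Fin n)) (x : Fin n → Bool) :
    ∏ i ∈ T, signv (x i) = 1 ∨ ∏ i ∈ T, signv (x i) = -1 := by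
  rw [prod_signv_eq_zsign]
  unfold zsign
  split_ifs <;> simp

/-- The sum of a character over a subcube vanishes or is the size of the subcube. -/
lemma sum_subcube_prod_signv {n : ℕ} {S T : Finset (Fin n)} (hT : T ⊆ S) :
    ∑ x ∈ Finset.univ.filter (fun x : Fin n → Bool => ∀ i, x i = true → i ∈ S),
      ∏ i ∈ T, signv (x i) = if T = ∅ then 2 ^ S.card else 0 := by
  let g : Fin n → Bool → ℝ := fun i b =>
    (if b = true → i ∈ S then 1 else 0) * (if i ∈ T then signv b else 1)
  have h : ∀ x : Fin n → Bool,
      (if ∀ i, x i = true → i ∈ S then ∏ i ∈ T, signv (x i) else 0) =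
        ∏ i, g i (x i) := by
    intro x
    simp only [g, Finset.prod_mul_distrib, Finset.prod_ite_zero]
    simp
  rw [Finset.sum_filter]
  rw [Finset.sum_congr rfl fun x _ => h x, ← Fintype.prod_sum g]
  split_ifs with hT0
  · subst hT0
    rw [← Finset.prod_subset (Finset.subset_univ S)]
    · refine Finset.prod_eq_pow_card fun i hi => ?_
      norm_num [g, hi]
    · intro i _ hi
      simp [g, hi]
  · obtain ⟨j, hj⟩ := Finset.nonempty_iff_ne_empty.2 hT0
    exact Finset.prod_eq_zero (Finset.mem_univ j) (by simp [g, hj, hT hj, signv])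

lemma sum_subcube_ne_zero {n : ℕ} {f : (Fin n → Bool) → ℝ} (hf : IsBooleanFunc f)
    {S T : Finset (Fin n)} (hT : T ⊆ S) (hS : f2Coeff f S ≠ 0) (hcard : 2 ≤ S.card) :
    ∑ x ∈ Finset.univ.filter (fun x : Fin n → Bool => ∀ i, x i = true → i ∈ S),
      f x * ∏ i ∈ T, signv (x i) ≠ 0 := by
  set Q := Finset.univ.filter (fun x : Fin n → Bool => ∀ i, x i = true → i ∈ S) with hQ
  have hodd : Odd (Q.filter (fun x => f x = -1)).card := by
    rw [← Nat.not_even_iff_odd, ← ZMod.natCast_eq_zero_iff_even, ← Finset.sum_boole]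
    exact hS
  obtain ⟨z, hz, hsum⟩ := exists_odd_sum_signs _ hodd _ (prod_signv_eq_or T)
  have h : ∀ x, f x * ∏ i ∈ T, signv (x i) = ∏ i ∈ T, signv (x i) -
      2 * (if f x = -1 then ∏ i ∈ T, signv (x i) else 0) := by
    intro x
    conv_lhs => rw [eq_one_sub_ite hf x]
    split_ifs <;> ring
  rw [Finset.sum_congr rfl fun x _ => h x, Finset.sum_sub_distrib, ← Finset.mul_sum,
    ← Finset.sum_filter, hsum, hQ, sum_subcube_prod_signv hT]
  obtain ⟨e, he⟩ := Nat.exists_eq_add_of_le hcard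
  obtain ⟨w, hw⟩ := hz
  intro h0
  split_ifs at h0
  · have h1 : (2 : ℤ) ^ S.card - 2 * z = 0 := by exact_mod_cast h0
    rw [he, pow_add] at h1
    omega
  · have h1 : (0 : ℤ) - 2 * z = 0 := by exact_mod_cast h0
    omega

lemma two_pow_f2Degree_le_sparsity {n : ℕ} {f : (Fin n → Bool) → ℝ} (hf : IsBooleanFunc f)
    (hk : 1 < sparsity f) : 2 ^ f2Degree f ≤ sparsity f := by
  rcases lt_or_ge (f2Degree f) 2 with hd | hd
  · calc 2 ^ f2Degree f ≤ 2 ^ 1 := Nat.pow_le_pow_right (by norm_num) (by omega)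
      _ ≤ sparsity f := hk
  have hne : (Finset.univ.filter (fun S : Finset (Fin n) => f2Coeff f S ≠ 0)).Nonempty := by
    rw [Finset.nonempty_iff_ne_empty]
    intro h
    rw [f2Degree, h, Finset.sup_empty] at hd
    simp at hd
  obtain ⟨S, hS, hSd⟩ := Finset.exists_mem_eq_sup _ hne Finset.card
  have hSd : f2Degree f = S.card := hSd
  rw [hSd, ← Finset.card_powerset]
  have hex : ∀ T ∈ S.powerset, ∃ U ∈ fourierSupport f, U ∩ S = T := by
    intro T hT
    rw [Finset.mem_powerset] at hT
    have hsum : ∑ W ∈ Sᶜ.powerset, fourierCoeff f (T ∪ W) ≠ 0 := by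
      rw [sum_fourierCoeff_union f hT]
      have := sum_subcube_ne_zero hf hT (Finset.mem_filter.1 hS).2 (hSd ▸ hd)
      positivity
    obtain ⟨W, hW, hWne⟩ := Finset.exists_ne_zero_of_sum_ne_zero hsum
    refine ⟨T ∪ W, by simpa [fourierSupport] using hWne, ?_⟩
    have hdisj : W ∩ S = ∅ := by
      rw [← Finset.disjoint_iff_inter_eq_empty]
      exact Finset.disjoint_of_subset_left (Finset.mem_powerset.1 hW) disjoint_compl_left
    rw [Finset.union_inter_distrib_right, hdisj, Finset.union_empty, Finset.inter_eq_left.2 hT]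
  refine (Finset.card_le_card fun T hT => ?_).trans
    (Finset.card_image_le (s := fourierSupport f) (f := fun U => U ∩ S))
  obtain ⟨U, hU, hUT⟩ := hex T hT
  exact Finset.mem_image.2 ⟨U, hU, hUT⟩

lemma f2Degree_le_logb_sparsity {n : ℕ} {f : (Fin n → Bool) → ℝ} (hf : IsBooleanFunc f)
    (hk : 1 < sparsity f) : (f2Degree f : ℝ) ≤ Real.logb 2 (sparsity f) := by
  rw [Real.le_logb_iff_rpow_le (by norm_num) (by exact_mod_cast (zero_lt_one.trans hk)),
    Real.rpow_natCast]
  exact_mod_cast two_pow_f2Degree_le_sparsity hf hk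

/-- **Corollary (basis version of the level-1 bound).** There is a universal constant
`C > 0` such that for every Boolean function `f` with `k(f) > 1` and every
`𝒮 ⊆ supp(f)` which is an `F₂`-basis of `span(supp(f))`,
`∑_{S ∈ 𝒮} |f̂(S)| ≤ C · δ(f) · deg₂(f) ≤ C · δ(f) · log₂ k(f)`. -/
theorem basis_level_bound :
    ∃ C : ℝ, 0 < C ∧
      ∀ (n : ℕ), 0 < n → ∀ f : (Fin n → Bool) → ℝ, IsBooleanFunc f →
        1 < sparsity f →
        ∀ 𝒮 : Finset (Finset (Fin n)), 𝒮 ⊆ fourierSupport f →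
          LinearIndependent (ZMod 2)
            (fun S : {T : Finset (Fin n) // T ∈ 𝒮} => indicatorVec S.1) →
          Submodule.span (ZMod 2) (indicatorVec '' (𝒮 : Set (Finset (Fin n)))) =
            Submodule.span (ZMod 2)
              (indicatorVec '' (fourierSupport f : Set (Finset (Fin n)))) →
          (∑ S ∈ 𝒮, |fourierCoeff f S|) ≤ C * weight f * (f2Degree f : ℝ) ∧
          (∑ S ∈ 𝒮, |fourierCoeff f S|) ≤ C * weight f * Real.logb 2 (sparsity f) := by
  refine ⟨2, two_pos, fun n _ f hf hk 𝒮 _ hli _ => ?_⟩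
  have hmain := sum_abs_fourierCoeff_le hf 𝒮 hli
  have hweight : 0 ≤ weight f := by
    unfold weight
    positivity
  exact ⟨hmain, hmain.trans
    (mul_le_mul_of_nonneg_left (f2Degree_le_logb_sparsity hf hk) (by positivity))⟩

end BoolFunc

end
end

section
/- For every positive integer n and every Boolean function f : {-1,1}^n → {-1,1} with δ(f) > 0, the Fourier ℓ₁-norm satisfies Σ_{S⊆[n]} |f̂(S)| ≤ 3·√(k(f)·δ(f)). -/
open scoped BigOperators
open scoped Classical

noncomputable section

namespace BoolFunc

/-- The character `χ_S` evaluated at a point of the cube. -/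
def walsh {n : ℕ} (S : Finset (Fin n)) (x : Fin n → Bool) : ℝ := ∏ i ∈ S, signv (x i)

lemma fourierCoeff_eq {n : ℕ} (f : (Fin n → Bool) → ℝ) (S : Finset (Fin n)) :
    fourierCoeff f S = (∑ x, f x * walsh S x) / 2 ^ n := rfl

lemma abs_walsh {n : ℕ} (S : Finset (Fin n)) (x : Fin n → Bool) : |walsh S x| = 1 := by
  unfold walsh
  rw [Finset.abs_prod]
  refine Finset.prod_eq_one fun i _ => ?_
  unfold signv
  split_ifs <;> simp

lemma sum_walsh_mul_walsh {n : ℕ} (x y : Fin n → Bool) :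
    ∑ S, walsh S x * walsh S y = if x = y then 2 ^ n else 0 := by
  have h : ∑ S, walsh S x * walsh S y = ∏ i, (1 + signv (x i) * signv (y i)) := by
    rw [Finset.prod_one_add, Finset.powerset_univ]
    exact Finset.sum_congr rfl fun S _ => Finset.prod_mul_distrib.symm
  rw [h]
  split_ifs with hxy
  · subst hxy
    have h2 : ∀ i, 1 + signv (x i) * signv (x i) = 2 := fun i => by
      unfold signv
      split_ifs <;> norm_num
    simp [h2]
  · obtain ⟨i, hi⟩ := Function.ne_iff.mp hxy
    refine Finset.prod_eq_zero (Finset.mem_univ i) ?_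
    unfold signv
    cases hx : x i <;> cases hy : y i <;> simp_all

lemma sum_fourierCoeff_mul_walsh {n : ℕ} (f : (Fin n → Bool) → ℝ) (x : Fin n → Bool) :
    ∑ S, fourierCoeff f S * walsh S x = f x := by
  have h : ∑ S, fourierCoeff f S * walsh S x
      = (∑ y, f y * ∑ S, walsh S y * walsh S x) / 2 ^ n := by
    simp_rw [fourierCoeff_eq, Finset.mul_sum, div_mul_eq_mul_div, Finset.sum_mul,
      ← Finset.sum_div]
    rw [Finset.sum_comm]
    simp_rw [mul_assoc]
  rw [h]
  simp [sum_walsh_mul_walsh]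

lemma sum_fourierCoeff_sq {n : ℕ} (f : (Fin n → Bool) → ℝ) :
    ∑ S, fourierCoeff f S ^ 2 = (∑ x, f x ^ 2) / 2 ^ n := by
  have h : ∑ S, fourierCoeff f S ^ 2
      = (∑ x, f x * ∑ S, fourierCoeff f S * walsh S x) / 2 ^ n := by
    simp_rw [Finset.mul_sum]
    rw [Finset.sum_comm, Finset.sum_div]
    refine Finset.sum_congr rfl fun S _ => ?_
    rw [sq]
    nth_rewrite 2 [fourierCoeff_eq]
    rw [← mul_div_assoc, Finset.mul_sum]
    congr 1
    exact Finset.sum_congr rfl fun x _ => by ring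
  rw [h]
  simp_rw [sum_fourierCoeff_mul_walsh, sq]

lemma fourierCoeff_one_of_ne_empty {n : ℕ} {S : Finset (Fin n)} (hS : S ≠ ∅) :
    fourierCoeff (fun _ => 1) S = 0 := by
  have h := sum_fourierCoeff_sq (n := n) fun _ => 1
  have h0 : fourierCoeff (n := n) (fun _ => 1) ∅ = 1 := by simp [fourierCoeff]
  rw [← Finset.add_sum_erase _ _ (Finset.mem_univ ∅), h0] at h
  have hz : ∑ T ∈ Finset.univ.erase ∅, fourierCoeff (n := n) (fun _ => 1) T ^ 2 = 0 := by
    simpa using h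
  rw [Finset.sum_eq_zero_iff_of_nonneg fun _ _ => sq_nonneg _] at hz
  exact pow_eq_zero_iff two_ne_zero |>.mp (hz S (by simp [hS]))

lemma IsBooleanFunc.sum_one_sub {n : ℕ} {f : (Fin n → Bool) → ℝ} (hf : IsBooleanFunc f) :
    (∑ x, (1 - f x)) / 2 ^ n = 2 * weight f := by
  have h : ∀ x, 1 - f x = if f x = -1 then 2 else 0 := fun x => by
    rcases hf x with h | h <;> norm_num [h]
  simp_rw [h, weight, ← Finset.sum_filter, Finset.sum_const, nsmul_eq_mul]
  ring

lemma IsBooleanFunc.fourierCoeff_empty {n : ℕ} {f : (Fin n → Bool) → ℝ}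
    (hf : IsBooleanFunc f) : fourierCoeff f ∅ = 1 - 2 * weight f := by
  rw [← hf.sum_one_sub]
  simp [fourierCoeff, sub_div]

lemma IsBooleanFunc.abs_fourierCoeff_le {n : ℕ} {f : (Fin n → Bool) → ℝ}
    (hf : IsBooleanFunc f) {S : Finset (Fin n)} (hS : S ≠ ∅) :
    |fourierCoeff f S| ≤ 2 * weight f := by
  have h : fourierCoeff f S = -((∑ x, (1 - f x) * walsh S x) / 2 ^ n) := by
    have h1 := fourierCoeff_one_of_ne_empty hS
    rw [fourierCoeff_eq] at h1 ⊢
    simp_rw [sub_mul, Finset.sum_sub_distrib, sub_div]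
    linarith
  rw [h, abs_neg, abs_div, abs_of_pos (by positivity : (0 : ℝ) < 2 ^ n), ← hf.sum_one_sub]
  gcongr
  refine (Finset.abs_sum_le_sum_abs _ _).trans_eq (Finset.sum_congr rfl fun x _ => ?_)
  rw [abs_mul, abs_walsh, mul_one, abs_of_nonneg]
  rcases hf x with h | h <;> norm_num [h]

lemma IsBooleanFunc.sum_fourierCoeff_sq_eq_one {n : ℕ} {f : (Fin n → Bool) → ℝ}
    (hf : IsBooleanFunc f) : ∑ S, fourierCoeff f S ^ 2 = 1 := by
  have h : ∀ x, f x ^ 2 = 1 := fun x => by rcases hf x with h | h <;> norm_num [h]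
  simp [sum_fourierCoeff_sq, h]

lemma sum_erase_empty_fourierCoeff {n : ℕ} (f : (Fin n → Bool) → ℝ) :
    ∑ S ∈ Finset.univ.erase ∅, |fourierCoeff f S|
      = ∑ S ∈ (fourierSupport f).erase ∅, |fourierCoeff f S| := by
  symm
  refine Finset.sum_subset (Finset.erase_subset_erase _ (Finset.subset_univ _)) ?_
  intro S hS hS'
  simp_all [fourierSupport]

/-- Uncertainty principle: the indicator of `f = -1` and its Fourier transform
cannot both have small support. -/
lemma IsBooleanFunc.one_le_sparsity_mul_weight {n : ℕ} {f : (Fin n → Bool) → ℝ}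
    (hf : IsBooleanFunc f) (hd : 0 < weight f) (h0 : fourierCoeff f ∅ ≠ 0) :
    1 ≤ (sparsity f : ℝ) * weight f := by
  obtain ⟨x, hx⟩ : ∃ x, f x = -1 := by
    by_contra! h
    simp [weight, h] at hd
  have hinv := sum_fourierCoeff_mul_walsh f x
  rw [← Finset.add_sum_erase _ _ (Finset.mem_univ ∅), hx, hf.fourierCoeff_empty] at hinv
  have hlow : 2 - 2 * weight f ≤ ∑ S ∈ Finset.univ.erase ∅, |fourierCoeff f S| := by
    have h1 := neg_abs_le (∑ S ∈ Finset.univ.erase ∅, fourierCoeff f S * walsh S x)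
    have h2 := Finset.abs_sum_le_sum_abs (fun S => fourierCoeff f S * walsh S x)
      (Finset.univ.erase ∅)
    simp_rw [abs_mul, abs_walsh, mul_one] at h2
    simp only [walsh, Finset.prod_empty, mul_one] at hinv h1 h2
    linarith
  have hup : ∑ S ∈ (fourierSupport f).erase ∅, |fourierCoeff f S|
      ≤ ((fourierSupport f).erase ∅).card • (2 * weight f) :=
    Finset.sum_le_card_nsmul _ _ _ fun S hS =>
      hf.abs_fourierCoeff_le (Finset.ne_of_mem_erase hS)
  have hcard : (((fourierSupport f).erase ∅).card : ℝ) + 1 = sparsity f := by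
    exact_mod_cast Finset.card_erase_add_one (s := fourierSupport f) (a := ∅)
      (by simp [fourierSupport, h0])
  rw [sum_erase_empty_fourierCoeff] at hlow
  rw [nsmul_eq_mul] at hup
  rw [← hcard]
  linarith

lemma IsBooleanFunc.sum_erase_empty_le {n : ℕ} {f : (Fin n → Bool) → ℝ}
    (hf : IsBooleanFunc f) :
    ∑ S ∈ Finset.univ.erase ∅, |fourierCoeff f S|
      ≤ 2 * Real.sqrt ((sparsity f : ℝ) * weight f) := by
  have hpars := hf.sum_fourierCoeff_sq_eq_one
  rw [← Finset.add_sum_erase _ _ (Finset.mem_univ ∅), hf.fourierCoeff_empty] at hpars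
  have hsub : ∑ S ∈ (fourierSupport f).erase ∅, |fourierCoeff f S| ^ 2
      ≤ ∑ S ∈ Finset.univ.erase ∅, fourierCoeff f S ^ 2 := by
    simp_rw [sq_abs]
    exact Finset.sum_le_sum_of_subset_of_nonneg
      (Finset.erase_subset_erase _ (Finset.subset_univ _)) fun _ _ _ => sq_nonneg _
  have hcs := sq_sum_le_card_mul_sum_sq (s := (fourierSupport f).erase ∅)
    (f := fun S => |fourierCoeff f S|)
  have hcard : (((fourierSupport f).erase ∅).card : ℝ) ≤ sparsity f := by
    exact_mod_cast Finset.card_erase_le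
  have hw : 0 ≤ weight f := by unfold weight; positivity
  rw [sum_erase_empty_fourierCoeff]
  have hsq : (∑ S ∈ (fourierSupport f).erase ∅, |fourierCoeff f S|) ^ 2
      ≤ 2 ^ 2 * ((sparsity f : ℝ) * weight f) := by
    calc _ ≤ _ := hcs
      _ ≤ (sparsity f : ℝ) * (4 * weight f) := by
        gcongr
        nlinarith [sq_nonneg (weight f)]
      _ = _ := by ring
  refine (Real.le_sqrt_of_sq_le hsq).trans_eq ?_
  rw [Real.sqrt_mul (by norm_num), Real.sqrt_sq (by norm_num)]

/-- **Claim.** For every Boolean function `f` with `δ(f) > 0`, the Fourier `ℓ₁`-norm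
satisfies `∑_S |f̂(S)| ≤ 3·√(k(f)·δ(f))`. -/
theorem l1_le_sqrt_sparsity_weight
    (n : ℕ) (hn : 0 < n) (f : (Fin n → Bool) → ℝ) (hf : IsBooleanFunc f)
    (hd : 0 < weight f) :
    (∑ S : Finset (Fin n), |fourierCoeff f S|) ≤
      3 * Real.sqrt ((sparsity f : ℝ) * weight f) := by
  have habs : |fourierCoeff f ∅| ≤ Real.sqrt ((sparsity f : ℝ) * weight f) := by
    by_cases h0 : fourierCoeff f ∅ = 0
    · rw [h0, abs_zero]
      exact Real.sqrt_nonneg _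
    · have hle : fourierCoeff f ∅ ^ 2 ≤ 1 := hf.sum_fourierCoeff_sq_eq_one ▸
        Finset.single_le_sum (f := fun S => fourierCoeff f S ^ 2)
          (fun _ _ => sq_nonneg _) (Finset.mem_univ ∅)
      exact Real.abs_le_sqrt (hle.trans (hf.one_le_sparsity_mul_weight hd h0))
  rw [← Finset.add_sum_erase _ _ (Finset.mem_univ ∅)]
  linarith [hf.sum_erase_empty_le]

end BoolFunc

end
end

section
/- Let f : {-1,1}^n → {-1,1} be a Boolean function and let Γ ⊆ F₂^n be a finite linearly independent set of nonzero vectors (parities). Define an equivalence relation on supp(f) by γ₁ ≡ γ₂ iff γ₁ + γ₂ ∈ span_{F₂}(Γ), and let ℓ ≥ 2 be the number of equivalence classes. For b ∈ {-1,1}^Γ let V_b = {x ∈ {-1,1}^n : χ_γ(x) = b_γ for all γ ∈ Γ}, where χ_γ(x) = Π_{i: γ_i = 1} x_i. Then there exists b ∈ {-1,1}^Γ such that the restriction f|_{V_b} is non-constant and satisfies δ(f|_{V_b}) / k(f|_{V_b}) ≤ 4·k(f)·δ(f)/ℓ², where δ(f|_{V_b}) = |{x ∈ V_b : f(x) = −1}|/|V_b|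 and k(f|_{V_b}) is the Fourier sparsity of the restriction of f to the affine subspace V_b (i.e., the Fourier sparsity of the Boolean function on {-1,1}^{n−|Γ|} obtained by identifying V_b with {-1,1}^{n−|Γ|} via an invertible affine transformation; this quantity does not depend on the identification). -/
open scoped BigOperators
open scoped Classical

noncomputable section

namespace BoolFunc

/-- The character `χ_γ(x) = ∏_{i : γᵢ = 1} xᵢ` (as a real number). -/
def chiVal {n : ℕ} (γ : Fin n → ZMod 2) (x : Fin n → Bool) : ℝ :=
  ∏ i ∈ Finset.univ.filter (fun i => γ i = 1), signv (x i)

/-- The `F₂`-version of a map between hypercubes. -/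
def toZ2 {m n : ℕ} (e : (Fin m → Bool) → (Fin n → Bool)) :
    (Fin m → ZMod 2) → (Fin n → ZMod 2) :=
  fun v i => if e (fun j => decide (v j = 1)) i then 1 else 0

/-- Number of equivalence classes of `supp(f)` under
`γ₁ ≡ γ₂ ↔ γ₁ + γ₂ ∈ span_{F₂}(Γ)`. -/
def numClasses {n : ℕ} (f : (Fin n → Bool) → ℝ) (Γ : Finset (Fin n → ZMod 2)) : ℕ :=
  ((fourierSupport f).image (fun S =>
    (Submodule.Quotient.mk (indicatorVec S) :
      (Fin n → ZMod 2) ⧸ Submodule.span (ZMod 2) (Γ : Set (Fin n → ZMod 2))))).card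

/-- Weight of the restriction of `f` to a subset `V` of the hypercube. -/
def restrWeight {n : ℕ} (f : (Fin n → Bool) → ℝ) (V : Set (Fin n → Bool)) : ℝ :=
  ((Finset.univ.filter (fun x : Fin n → Bool => x ∈ V ∧ f x = -1)).card : ℝ) /
    ((Finset.univ.filter (fun x : Fin n → Bool => x ∈ V)).card : ℝ)

/-- The nontrivial additive character of `ZMod 2` with real values. -/
def sgn (a : ZMod 2) : ℝ := if a = 1 then -1 else 1

lemma sgn_zero : sgn 0 = 1 := by simp [sgn]

lemma sgn_one : sgn 1 = -1 := by simp [sgn]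

lemma zmod_two_cases (a : ZMod 2) : a = 0 ∨ a = 1 := by
  revert a; decide

lemma sgn_add (a b : ZMod 2) : sgn (a + b) = sgn a * sgn b := by
  have h : (1 + 1 : ZMod 2) = 0 := by decide
  rcases zmod_two_cases a with rfl | rfl <;> rcases zmod_two_cases b with rfl | rfl <;>
    simp [h, sgn_zero, sgn_one]

lemma sgn_mul_self (a : ZMod 2) : sgn a * sgn a = 1 := by
  rcases zmod_two_cases a with rfl | rfl <;> simp [sgn_zero, sgn_one]

lemma sgn_ne_zero (a : ZMod 2) : sgn a ≠ 0 := by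
  rcases zmod_two_cases a with rfl | rfl <;> simp [sgn_zero, sgn_one]

lemma sgn_injective : Function.Injective sgn := by
  intro a b h
  rcases zmod_two_cases a with rfl | rfl <;> rcases zmod_two_cases b with rfl | rfl <;>
    first | rfl | norm_num [sgn_zero, sgn_one] at h

lemma sgn_sum {ι : Type*} (s : Finset ι) (a : ι → ZMod 2) :
    sgn (∑ i ∈ s, a i) = ∏ i ∈ s, sgn (a i) := by
  induction s using Finset.induction_on with
  | empty => simp [sgn_zero]
  | insert i s hi ih => rw [Finset.sum_insert hi, Finset.prod_insert hi, sgn_add, ih]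

section

variable {n m : ℕ}

lemma vec_add_self (v : Fin n → ZMod 2) : v + v = 0 :=
  funext fun i => CharTwo.add_self_eq_zero (v i)

lemma vec_sub_eq_add (v w : Fin n → ZMod 2) : v - w = v + w :=
  funext fun i => CharTwo.sub_eq_add (v i) (w i)

/-- Fourier coefficients of functions on `F₂ⁿ`. -/
def hat (F : (Fin n → ZMod 2) → ℝ) (γ : Fin n → ZMod 2) : ℝ :=
  (∑ v, F v * sgn (γ ⬝ᵥ v)) / 2 ^ n

/-- The common orthogonal complement of the parities in `Γ`. -/
def orth (Γ : Finset (Fin n → ZMod 2)) : Submodule (ZMod 2) (Fin n → ZMod 2) where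
  carrier := {y | ∀ γ ∈ Γ, γ ⬝ᵥ y = 0}
  add_mem' := by
    intro a b ha hb γ hγ
    rw [dotProduct_add, ha γ hγ, hb γ hγ, add_zero]
  zero_mem' := by intro γ _; simp
  smul_mem' := by
    intro c a ha γ hγ
    rw [dotProduct_smul, ha γ hγ, smul_zero]

lemma mem_orth {Γ : Finset (Fin n → ZMod 2)} {y : Fin n → ZMod 2} :
    y ∈ orth Γ ↔ ∀ γ ∈ Γ, γ ⬝ᵥ y = 0 := Iff.rfl

lemma dotProduct_eq_zero_of_mem_span {Γ : Finset (Fin n → ZMod 2)} {y τ : Fin n → ZMod 2}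
    (hy : y ∈ orth Γ) (hτ : τ ∈ Submodule.span (ZMod 2) (Γ : Set (Fin n → ZMod 2))) :
    τ ⬝ᵥ y = 0 := by
  induction hτ using Submodule.span_induction with
  | mem x hx => exact hy x hx
  | zero => simp
  | add a b _ _ ha hb => rw [add_dotProduct, ha, hb, add_zero]
  | smul c a _ ha => rw [smul_dotProduct, ha, smul_zero]

lemma exists_mem_orth_of_notMem_span {Γ : Finset (Fin n → ZMod 2)} {τ : Fin n → ZMod 2}
    (hτ : τ ∉ Submodule.span (ZMod 2) (Γ : Set (Fin n → ZMod 2))) :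
    ∃ y ∈ orth Γ, τ ⬝ᵥ y = 1 := by
  obtain ⟨g, hg, hle⟩ := Submodule.exists_le_ker_of_notMem hτ
  have key : ∀ v, v ⬝ᵥ (fun i => g (Pi.single i 1)) = g v := by
    intro v
    rw [LinearMap.pi_apply_eq_sum_univ g v]
    simp only [dotProduct, smul_eq_mul]
    refine Finset.sum_congr rfl fun i _ => ?_
    congr 2
    ext j
    simp [Pi.single_apply, eq_comm]
  refine ⟨fun i => g (Pi.single i 1), fun γ hγ => ?_, ?_⟩
  · rw [key]
    exact hle (Submodule.subset_span hγ)
  · rw [key]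
    exact (zmod_two_cases _).resolve_left hg

lemma sum_sgn_submodule_eq_zero (K : Submodule (ZMod 2) (Fin n → ZMod 2))
    {τ y : Fin n → ZMod 2} (hy : y ∈ K) (h : τ ⬝ᵥ y = 1) :
    ∑ v : K, sgn (τ ⬝ᵥ (v : Fin n → ZMod 2)) = 0 := by
  have h1 : ∑ v : K, sgn (τ ⬝ᵥ (v : Fin n → ZMod 2)) =
      ∑ v : K, sgn (τ ⬝ᵥ ((v + ⟨y, hy⟩ : K) : Fin n → ZMod 2)) :=
    (Equiv.sum_comp (Equiv.addRight (⟨y, hy⟩ : K))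
      (fun v : K => sgn (τ ⬝ᵥ (v : Fin n → ZMod 2)))).symm
  simp only [Submodule.coe_add, dotProduct_add, h, sgn_add, sgn_one, mul_neg, mul_one,
    Finset.sum_neg_distrib] at h1
  linarith

lemma sum_sgn_orth (Γ : Finset (Fin n → ZMod 2)) (τ : Fin n → ZMod 2) :
    ∑ v : orth Γ, sgn (τ ⬝ᵥ (v : Fin n → ZMod 2)) =
      if τ ∈ Submodule.span (ZMod 2) (Γ : Set (Fin n → ZMod 2)) then
        (Fintype.card (orth Γ) : ℝ) else 0 := by
  split_ifs with h
  · rw [Finset.sum_congr rfl fun v _ => by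
      rw [dotProduct_eq_zero_of_mem_span v.2 h, sgn_zero]]
    simp
  · obtain ⟨y, hy, hy1⟩ := exists_mem_orth_of_notMem_span h
    exact sum_sgn_submodule_eq_zero _ hy hy1

lemma sum_sgn (τ : Fin n → ZMod 2) :
    ∑ v, sgn (τ ⬝ᵥ v) = if τ = 0 then (2 : ℝ) ^ n else 0 := by
  split_ifs with h
  · simp [h, sgn_zero, ZMod.card]
  · obtain ⟨i, hi⟩ := Function.ne_iff.mp h
    have h1 := sum_sgn_submodule_eq_zero ⊤ (τ := τ) (y := Pi.single i 1) trivial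
      (by simpa using (zmod_two_cases (τ i)).resolve_left hi)
    rw [← h1]
    exact (Fintype.sum_equiv Submodule.topEquiv.toEquiv _ _ fun _ => rfl).symm

lemma sum_hat_mul_sgn (F : (Fin n → ZMod 2) → ℝ) (x : Fin n → ZMod 2) :
    ∑ γ, hat F γ * sgn (γ ⬝ᵥ x) = F x := by
  have h : ∀ γ, hat F γ * sgn (γ ⬝ᵥ x) =
      ∑ v, F v / 2 ^ n * sgn ((v + x) ⬝ᵥ γ) := by
    intro γ
    rw [hat, Finset.sum_div, Finset.sum_mul]
    refine Finset.sum_congr rfl fun v _ => ?_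
    rw [dotProduct_comm (v + x), dotProduct_add, sgn_add]
    ring
  simp_rw [h]
  rw [Finset.sum_comm]
  simp_rw [← Finset.mul_sum, sum_sgn]
  have h2 : ∀ v, v + x = 0 ↔ v = x := fun v => by
    rw [← vec_sub_eq_add, sub_eq_zero]
  simp [h2]

lemma sum_sq_of_sgn_sum (A : Finset (Fin n → ZMod 2)) (c : (Fin n → ZMod 2) → ℝ) :
    ∑ x, (∑ γ ∈ A, c γ * sgn (γ ⬝ᵥ x)) ^ 2 = 2 ^ n * ∑ γ ∈ A, c γ ^ 2 := by
  have h : ∀ x, (∑ γ ∈ A, c γ * sgn (γ ⬝ᵥ x)) ^ 2 =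
      ∑ γ ∈ A, ∑ τ ∈ A, c γ * c τ * sgn ((γ + τ) ⬝ᵥ x) := by
    intro x
    rw [sq, Finset.sum_mul_sum]
    refine Finset.sum_congr rfl fun γ _ => Finset.sum_congr rfl fun τ _ => ?_
    rw [add_dotProduct, sgn_add]
    ring
  simp_rw [h]
  rw [Finset.sum_comm, Finset.mul_sum]
  refine Finset.sum_congr rfl fun γ hγ => ?_
  rw [Finset.sum_comm]
  simp_rw [← Finset.mul_sum, sum_sgn]
  have h2 : ∀ τ, γ + τ = 0 ↔ γ = τ := fun v => by
    rw [← vec_sub_eq_add, sub_eq_zero]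
  simp [h2, hγ]
  ring

/-- Uncertainty principle: a nonzero function with few Fourier coefficients has large support. -/
lemma two_pow_le_card_mul_card_ne_zero (A : Finset (Fin n → ZMod 2))
    (c : (Fin n → ZMod 2) → ℝ) (hc : ∃ γ ∈ A, c γ ≠ 0) :
    (2 : ℝ) ^ n ≤ A.card *
      (Finset.univ.filter fun x : Fin n → ZMod 2 =>
        ∑ γ ∈ A, c γ * sgn (γ ⬝ᵥ x) ≠ 0).card := by
  set g : (Fin n → ZMod 2) → ℝ := fun x => ∑ γ ∈ A, c γ * sgn (γ ⬝ᵥ x) with hg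
  have hpos : 0 < ∑ γ ∈ A, c γ ^ 2 := by
    obtain ⟨γ, hγ, h0⟩ := hc
    exact Finset.sum_pos' (fun _ _ => sq_nonneg _) ⟨γ, hγ, by positivity⟩
  have hbound : ∀ x, g x ^ 2 ≤ A.card * ∑ γ ∈ A, c γ ^ 2 := by
    intro x
    refine sq_sum_le_card_mul_sum_sq.trans (le_of_eq ?_)
    congr 1
    refine Finset.sum_congr rfl fun γ _ => ?_
    rw [mul_pow, sq (sgn _), sgn_mul_self, mul_one]
  have hsum := sum_sq_of_sgn_sum A c
  have h1 : ∑ x, g x ^ 2 = ∑ x ∈ Finset.univ.filter (fun x => g x ≠ 0), g x ^ 2 := by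
    rw [Finset.sum_filter]
    refine Finset.sum_congr rfl fun x _ => ?_
    split_ifs with h
    · rfl
    · rw [not_not.mp h]; simp
  have h2 : ∑ x ∈ Finset.univ.filter (fun x => g x ≠ 0), g x ^ 2 ≤
      (Finset.univ.filter (fun x => g x ≠ 0)).card * (A.card * ∑ γ ∈ A, c γ ^ 2) := by
    rw [← nsmul_eq_mul]
    exact Finset.sum_le_card_nsmul _ _ _ fun x _ => hbound x
  have h3 : 2 ^ n * ∑ γ ∈ A, c γ ^ 2 ≤
      (A.card * (Finset.univ.filter (fun x => g x ≠ 0)).card) * ∑ γ ∈ A, c γ ^ 2 := by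
    rw [← hsum]
    change ∑ x, g x ^ 2 ≤ _
    rw [h1]
    refine h2.trans (le_of_eq (by ring))
  exact le_of_mul_le_mul_right h3 hpos

/-- The quotient of the parities by the span of `Γ`. -/
abbrev ParityQuot (Γ : Finset (Fin n → ZMod 2)) : Type :=
  (Fin n → ZMod 2) ⧸ Submodule.span (ZMod 2) (Γ : Set (Fin n → ZMod 2))

/-- The class of a parity modulo the span of `Γ`. -/
abbrev parityClass (Γ : Finset (Fin n → ZMod 2)) (γ : Fin n → ZMod 2) : ParityQuot Γ :=
  Submodule.Quotient.mk γ

/-- The Fourier support of a function on `F₂ⁿ`. -/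
def hatSupport (F : (Fin n → ZMod 2) → ℝ) : Finset (Fin n → ZMod 2) :=
  Finset.univ.filter fun γ => hat F γ ≠ 0

/-- The part of the Fourier support in a given class. -/
def classSupport (F : (Fin n → ZMod 2) → ℝ) (Γ : Finset (Fin n → ZMod 2))
    (C : ParityQuot Γ) : Finset (Fin n → ZMod 2) :=
  (hatSupport F).filter fun γ => parityClass Γ γ = C

/-- The part of the Fourier expansion with parities in a given class. -/
def classPart (F : (Fin n → ZMod 2) → ℝ) (Γ : Finset (Fin n → ZMod 2))
    (C : ParityQuot Γ) (x : Fin n → ZMod 2) : ℝ :=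
  ∑ γ ∈ classSupport F Γ C, hat F γ * sgn (γ ⬝ᵥ x)

/-- The nonzero classes meeting the Fourier support. -/
def nonzeroClasses (F : (Fin n → ZMod 2) → ℝ) (Γ : Finset (Fin n → ZMod 2)) :
    Finset (ParityQuot Γ) :=
  ((hatSupport F).image (parityClass Γ)).erase 0

/-- The nonzero classes whose part does not vanish at `x`. -/
def activeClasses (F : (Fin n → ZMod 2) → ℝ) (Γ : Finset (Fin n → ZMod 2))
    (x : Fin n → ZMod 2) : Finset (ParityQuot Γ) :=
  (nonzeroClasses F Γ).filter fun C => classPart F Γ C x ≠ 0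

/-- Density of `{F = -1}` in the coset `x + Γ^⊥`. -/
def cosetWeight (F : (Fin n → ZMod 2) → ℝ) (Γ : Finset (Fin n → ZMod 2))
    (x : Fin n → ZMod 2) : ℝ :=
  ((Finset.univ.filter fun y : orth Γ => F (x + y) = -1).card : ℝ) / Fintype.card (orth Γ)

lemma sum_coset (F : (Fin n → ZMod 2) → ℝ) (Γ : Finset (Fin n → ZMod 2))
    (τ x : Fin n → ZMod 2) :
    ∑ y : orth Γ, F (x + y) * sgn (τ ⬝ᵥ (x + y)) =
      Fintype.card (orth Γ) * (sgn (τ ⬝ᵥ x) * classPart F Γ (parityClass Γ τ) x) := by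
  have h : ∀ y : orth Γ, F (x + y) * sgn (τ ⬝ᵥ (x + y)) =
      ∑ γ, hat F γ * sgn ((γ + τ) ⬝ᵥ x) * sgn ((γ + τ) ⬝ᵥ (y : Fin n → ZMod 2)) := by
    intro y
    rw [← sum_hat_mul_sgn F (x + y), Finset.sum_mul]
    refine Finset.sum_congr rfl fun γ _ => ?_
    simp only [dotProduct_add, add_dotProduct, sgn_add]
    ring
  simp_rw [h]
  rw [Finset.sum_comm]
  simp_rw [← Finset.mul_sum, sum_sgn_orth]
  rw [classPart, classSupport, hatSupport, Finset.filter_filter, Finset.sum_filter,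
    Finset.mul_sum, Finset.mul_sum]
  refine Finset.sum_congr rfl fun γ _ => ?_
  have hiff : parityClass Γ γ = parityClass Γ τ ↔
      γ + τ ∈ Submodule.span (ZMod 2) (Γ : Set (Fin n → ZMod 2)) := by
    rw [← vec_sub_eq_add]
    exact Submodule.Quotient.eq _
  by_cases h0 : hat F γ = 0
  · simp [h0]
  · by_cases h1 : γ + τ ∈ Submodule.span (ZMod 2) (Γ : Set (Fin n → ZMod 2))
    · rw [if_pos h1, if_pos ⟨h0, hiff.mpr h1⟩, add_dotProduct, sgn_add]
      ring
    · rw [if_neg h1, if_neg fun hh => h1 (hiff.mp hh.2)]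
      simp

lemma sum_cosetWeight (F : (Fin n → ZMod 2) → ℝ) (Γ : Finset (Fin n → ZMod 2)) :
    ∑ x, cosetWeight F Γ x = (Finset.univ.filter fun x => F x = -1).card := by
  simp only [cosetWeight]
  have hK : (Fintype.card (orth Γ) : ℝ) ≠ 0 := by
    exact_mod_cast Fintype.card_ne_zero
  rw [← Finset.sum_div, div_eq_iff hK]
  simp only [Finset.card_filter, Nat.cast_sum]
  rw [Finset.sum_comm]
  have h : ∀ y : orth Γ, ∑ x, ((if F (x + y) = -1 then 1 else 0 : ℕ) : ℝ) =
      ∑ x, ((if F x = -1 then 1 else 0 : ℕ) : ℝ) := fun y =>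
    Equiv.sum_comp (Equiv.addRight (y : Fin n → ZMod 2))
      (fun x => ((if F x = -1 then 1 else 0 : ℕ) : ℝ))
  simp_rw [h]
  rw [Finset.sum_const, nsmul_eq_mul, Finset.card_univ, mul_comm]

lemma classSupport_nonempty {F : (Fin n → ZMod 2) → ℝ} {Γ : Finset (Fin n → ZMod 2)}
    {C : ParityQuot Γ} (hC : C ∈ nonzeroClasses F Γ) : (classSupport F Γ C).Nonempty := by
  obtain ⟨γ, hγ, rfl⟩ := Finset.mem_image.mp (Finset.mem_of_mem_erase hC)
  exact ⟨γ, Finset.mem_filter.mpr ⟨hγ, rfl⟩⟩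

lemma sum_card_classSupport_le (F : (Fin n → ZMod 2) → ℝ) (Γ : Finset (Fin n → ZMod 2)) :
    ∑ C ∈ nonzeroClasses F Γ, (classSupport F Γ C).card ≤ (hatSupport F).card := by
  simp only [classSupport]
  rw [← Finset.card_biUnion fun C _ D _ hCD => Finset.disjoint_filter.mpr
    fun γ _ h h' => hCD (h.symm.trans h')]
  exact Finset.card_le_card (Finset.biUnion_subset.mpr fun C _ => Finset.filter_subset _ _)

lemma sum_card_activeClasses (F : (Fin n → ZMod 2) → ℝ) (Γ : Finset (Fin n → ZMod 2)) :
    2 ^ n * ((nonzeroClasses F Γ).card : ℝ) ^ 2 ≤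
      (hatSupport F).card * ∑ x, ((activeClasses F Γ x).card : ℝ) := by
  have hswap : ∑ x, ((activeClasses F Γ x).card : ℝ) =
      ∑ C ∈ nonzeroClasses F Γ,
        ((Finset.univ.filter fun x => classPart F Γ C x ≠ 0).card : ℝ) := by
    simp only [activeClasses, Finset.card_filter, Nat.cast_sum]
    exact Finset.sum_comm
  have hunc : ∀ C ∈ nonzeroClasses F Γ, (2 : ℝ) ^ n / (classSupport F Γ C).card ≤
      (Finset.univ.filter fun x => classPart F Γ C x ≠ 0).card := by
    intro C hC
    obtain ⟨γ, hγ⟩ := classSupport_nonempty hC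
    have hpos : (0 : ℝ) < (classSupport F Γ C).card := by
      exact_mod_cast Finset.card_pos.mpr ⟨γ, hγ⟩
    rw [div_le_iff₀' hpos]
    exact two_pow_le_card_mul_card_ne_zero _ _
      ⟨γ, hγ, (Finset.mem_filter.mp (Finset.mem_filter.mp hγ).1).2⟩
  have hcs := Finset.sum_sq_le_sum_mul_sum_of_sq_le_mul (nonzeroClasses F Γ)
    (r := fun _ => (1 : ℝ)) (f := fun C => ((classSupport F Γ C).card : ℝ))
    (g := fun C => 1 / ((classSupport F Γ C).card : ℝ))
    (fun _ _ => by positivity) (fun _ _ => by positivity) (fun C hC => by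
      have hpos : ((classSupport F Γ C).card : ℝ) ≠ 0 := by
        exact_mod_cast (Finset.card_pos.mpr (classSupport_nonempty hC)).ne'
      field_simp
      exact le_rfl)
  rw [Finset.sum_const, nsmul_eq_mul, mul_one] at hcs
  have hk : ∑ C ∈ nonzeroClasses F Γ, ((classSupport F Γ C).card : ℝ) ≤
      (hatSupport F).card := by exact_mod_cast sum_card_classSupport_le F Γ
  calc 2 ^ n * ((nonzeroClasses F Γ).card : ℝ) ^ 2
      ≤ 2 ^ n * ((hatSupport F).card *
          ∑ C ∈ nonzeroClasses F Γ, 1 / ((classSupport F Γ C).card : ℝ)) := by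
        gcongr
        exact hcs.trans (by gcongr)
    _ = (hatSupport F).card *
          ∑ C ∈ nonzeroClasses F Γ, (2 : ℝ) ^ n / ((classSupport F Γ C).card : ℝ) := by
        simp_rw [div_eq_mul_one_div ((2 : ℝ) ^ n), ← Finset.mul_sum]
        ring
    _ ≤ _ := by
        rw [hswap]
        gcongr with C hC
        exact hunc C hC

lemma exists_cosetWeight_le (F : (Fin n → ZMod 2) → ℝ) (Γ : Finset (Fin n → ZMod 2))
    (hl : 2 ≤ ((hatSupport F).image (parityClass Γ)).card) :
    ∃ x, 0 < (activeClasses F Γ x).card ∧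
      cosetWeight F Γ x ≤ (4 * ((hatSupport F).card : ℝ) *
        (((Finset.univ.filter fun x => F x = -1).card : ℝ) / 2 ^ n) /
          (((hatSupport F).image (parityClass Γ)).card : ℝ) ^ 2) *
        (activeClasses F Γ x).card := by
  set l := ((hatSupport F).image (parityClass Γ)).card with hldef
  set k : ℝ := ((hatSupport F).card : ℝ) with hk
  set N : ℝ := ((Finset.univ.filter fun x => F x = -1).card : ℝ) with hN
  have hl2 : (2 : ℝ) ≤ l := by exact_mod_cast hl
  have hkpos : 0 < k := by
    have : l ≤ (hatSupport F).card := Finset.card_image_le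
    rw [hk]
    exact_mod_cast (by omega : 0 < (hatSupport F).card)
  have hl' : (l : ℝ) ≤ 2 * (nonzeroClasses F Γ).card := by
    have : l - 1 ≤ (nonzeroClasses F Γ).card := Finset.pred_card_le_card_erase
    exact_mod_cast (by omega : l ≤ 2 * (nonzeroClasses F Γ).card)
  have hsum := sum_card_activeClasses F Γ
  have hM : (2 : ℝ) ^ n * l ^ 2 ≤ 4 * (k * ∑ x, ((activeClasses F Γ x).card : ℝ)) := by
    have hsq : (l : ℝ) ^ 2 ≤ (2 * (nonzeroClasses F Γ).card) ^ 2 := by gcongr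
    calc (2 : ℝ) ^ n * l ^ 2 ≤ 2 ^ n * (2 * (nonzeroClasses F Γ).card) ^ 2 := by gcongr
      _ = 4 * (2 ^ n * ((nonzeroClasses F Γ).card : ℝ) ^ 2) := by ring
      _ ≤ _ := by gcongr
  have hN0 : 0 ≤ N := Nat.cast_nonneg _
  set R : ℝ := 4 * k * (N / 2 ^ n) / (l : ℝ) ^ 2 with hR
  have hNR : N ≤ R * ∑ x, ((activeClasses F Γ x).card : ℝ) := by
    have hd : (0 : ℝ) < 2 ^ n * l ^ 2 := by positivity
    calc N ≤ N * (4 * (k * ∑ x, ((activeClasses F Γ x).card : ℝ))) / (2 ^ n * l ^ 2) := by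
          rw [le_div_iff₀ hd]
          exact mul_le_mul_of_nonneg_left hM hN0
      _ = R * ∑ x, ((activeClasses F Γ x).card : ℝ) := by
          rw [hR]
          generalize ∑ x, ((activeClasses F Γ x).card : ℝ) = M
          ring
  have hMpos : 0 < ∑ x, ((activeClasses F Γ x).card : ℝ) := by
    have : (0 : ℝ) < 2 ^ n * l ^ 2 := by positivity
    have h4 := lt_of_lt_of_le this hM
    exact pos_of_mul_pos_right (by linarith : 0 < k * ∑ x, ((activeClasses F Γ x).card : ℝ))
      hkpos.le
  by_contra! hcon
  obtain ⟨x₀, -, hx₀⟩ := Finset.exists_ne_zero_of_sum_ne_zero hMpos.ne'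
  have hx₀' : 0 < (activeClasses F Γ x₀).card := Nat.pos_of_ne_zero (by exact_mod_cast hx₀)
  have hlt : ∑ x, R * ((activeClasses F Γ x).card : ℝ) < ∑ x, cosetWeight F Γ x := by
    refine Finset.sum_lt_sum (fun x _ => ?_) ⟨x₀, Finset.mem_univ _, hcon x₀ hx₀'⟩
    rcases Nat.eq_zero_or_pos (activeClasses F Γ x).card with h | h
    · rw [h, Nat.cast_zero, mul_zero, cosetWeight]
      positivity
    · exact (hcon x h).le
  rw [sum_cosetWeight, ← Finset.mul_sum] at hlt
  linarith

lemma exists_ne_on_coset {F : (Fin n → ZMod 2) → ℝ} {Γ : Finset (Fin n → ZMod 2)}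
    {x : Fin n → ZMod 2} (h : 0 < (activeClasses F Γ x).card) :
    ∃ y : orth Γ, F x ≠ F (x + y) := by
  by_contra! hcon
  obtain ⟨C, hC⟩ := Finset.card_pos.mp h
  obtain ⟨hC, hne⟩ := Finset.mem_filter.mp hC
  obtain ⟨τ, rfl⟩ := Submodule.Quotient.mk_surjective _ C
  have hτ : τ ∉ Submodule.span (ZMod 2) (Γ : Set (Fin n → ZMod 2)) := fun hmem =>
    Finset.ne_of_mem_erase hC ((Submodule.Quotient.mk_eq_zero _).mpr hmem)
  have hsum := sum_coset F Γ τ x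
  simp_rw [← hcon, dotProduct_add, sgn_add, ← Finset.mul_sum, sum_sgn_orth, if_neg hτ] at hsum
  have hK : (Fintype.card (orth Γ) : ℝ) ≠ 0 := by exact_mod_cast Fintype.card_ne_zero
  simp only [mul_zero] at hsum
  exact mul_ne_zero hK (mul_ne_zero (sgn_ne_zero _) hne) hsum.symm

lemma exists_dotProduct_affine {e : (Fin m → ZMod 2) → (Fin n → ZMod 2)}
    (he : ∀ u v w, e (u + v + w) = e u + e v + e w) (τ : Fin n → ZMod 2) :
    ∃ σ : Fin m → ZMod 2, ∀ u, τ ⬝ᵥ e u = τ ⬝ᵥ e 0 + σ ⬝ᵥ u := by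
  let φ : (Fin m → ZMod 2) →+ ZMod 2 :=
    { toFun := fun u => τ ⬝ᵥ (e u + e 0)
      map_zero' := by rw [vec_add_self, dotProduct_zero]
      map_add' := fun u v => by
        have := he u v 0
        rw [add_zero] at this
        rw [this, ← dotProduct_add]
        congr 1
        rw [add_assoc (e u + e v), vec_add_self, add_zero, add_add_add_comm, vec_add_self,
          add_zero] }
  let L := φ.toZModLinearMap 2
  refine ⟨fun i => L (Pi.single i 1), fun u => ?_⟩
  have h1 : (fun i => L (Pi.single i 1)) ⬝ᵥ u = L u := by
    rw [LinearMap.pi_apply_eq_sum_univ L u]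
    simp only [dotProduct, smul_eq_mul]
    refine Finset.sum_congr rfl fun i _ => ?_
    rw [mul_comm]
    congr 2
    ext j
    simp [Pi.single_apply, eq_comm]
  rw [h1]
  change τ ⬝ᵥ e u = τ ⬝ᵥ e 0 + τ ⬝ᵥ (e u + e 0)
  rw [← dotProduct_add, add_left_comm, vec_add_self, add_zero]

lemma card_activeClasses_le (F : (Fin n → ZMod 2) → ℝ) (Γ : Finset (Fin n → ZMod 2))
    (x : Fin n → ZMod 2) {e : (Fin m → ZMod 2) → (Fin n → ZMod 2)}
    (hinj : Function.Injective e) (hrange : ∀ v, v ∈ Set.range e ↔ v + x ∈ orth Γ)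
    (he : ∀ u v w, e (u + v + w) = e u + e v + e w) :
    (activeClasses F Γ x).card ≤ (hatSupport (F ∘ e)).card := by
  choose σ hσ using exists_dotProduct_affine he
  have hmem : ∀ u, e u + x ∈ orth Γ := fun u => (hrange _).mp ⟨u, rfl⟩
  have hxx : ∀ y : Fin n → ZMod 2, x + (y + x) = y := fun y => by
    rw [add_left_comm, vec_add_self, add_zero]
  let E : (Fin m → ZMod 2) ≃ orth Γ := Equiv.ofBijective (fun u => ⟨e u + x, hmem u⟩)
    ⟨fun u v h => hinj (add_right_cancel (Subtype.ext_iff.mp h)), fun y => by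
      obtain ⟨u, hu⟩ := (hrange (y + x)).mpr (by
        rw [add_assoc, vec_add_self, add_zero]; exact y.2)
      refine ⟨u, Subtype.ext ?_⟩
      change e u + x = y
      rw [hu, add_assoc, vec_add_self, add_zero]⟩
  have hE : ∀ u, x + (E u : Fin n → ZMod 2) = e u := fun u => hxx _
  have hhat : ∀ τ, hat (F ∘ e) (σ τ) = sgn (τ ⬝ᵥ e 0) *
      (Fintype.card (orth Γ) * (sgn (τ ⬝ᵥ x) * classPart F Γ (parityClass Γ τ) x)) / 2 ^ m := by
    intro τ
    rw [hat, ← sum_coset, ← Equiv.sum_comp E, Finset.mul_sum]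
    congr 1
    refine Finset.sum_congr rfl fun u _ => ?_
    rw [hE, hσ τ u, sgn_add, Function.comp_apply]
    linear_combination (-(F (e u) * sgn (σ τ ⬝ᵥ u))) * sgn_mul_self (τ ⬝ᵥ e 0)
  have hK : (Fintype.card (orth Γ) : ℝ) ≠ 0 := by exact_mod_cast Fintype.card_ne_zero
  have hout : ∀ C : ParityQuot Γ, parityClass Γ C.out = C := fun C => Quotient.out_eq' C
  refine Finset.card_le_card_of_injOn (fun C => σ C.out) (fun C hC => ?_) fun C _ D _ hCD => ?_
  · have hC := (Finset.mem_filter.mp hC).2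
    refine Finset.mem_coe.mpr (Finset.mem_filter.mpr ⟨Finset.mem_univ _, ?_⟩)
    rw [hhat, hout]
    exact div_ne_zero (mul_ne_zero (sgn_ne_zero _)
      (mul_ne_zero hK (mul_ne_zero (sgn_ne_zero _) hC))) (by positivity)
  · rw [← hout C, ← hout D]
    refine (Submodule.Quotient.eq _).mpr ?_
    by_contra hnot
    obtain ⟨y, hy, hy1⟩ := exists_mem_orth_of_notMem_span hnot
    have hdiff : y = e (E.symm ⟨y, hy⟩) - e (E.symm 0) := by
      rw [← hE, ← hE, E.apply_symm_apply, E.apply_symm_apply]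
      simp
    have hconst : ∀ u, (C.out - D.out) ⬝ᵥ e u = (C.out - D.out) ⬝ᵥ e 0 := fun u => by
      have hCD : σ C.out = σ D.out := hCD
      rw [sub_dotProduct, sub_dotProduct, hσ C.out u, hσ D.out u, hCD]
      ring
    rw [hdiff, dotProduct_sub, hconst, hconst (E.symm 0), sub_self] at hy1
    exact zero_ne_one hy1

/-- The identification of `F₂ⁿ` with the hypercube. -/
def cubeEquiv (n : ℕ) : (Fin n → ZMod 2) ≃ (Fin n → Bool) where
  toFun v := fun j => decide (v j = 1)
  invFun x := fun i => if x i then 1 else 0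
  left_inv v := by
    funext i
    rcases zmod_two_cases (v i) with h | h <;> simp [h]
  right_inv x := by
    funext i
    cases h : x i <;> simp [h]

lemma chiVal_eq_sgn (γ : Fin n → ZMod 2) (x : Fin n → Bool) :
    chiVal γ x = sgn (γ ⬝ᵥ (cubeEquiv n).symm x) := by
  rw [chiVal, Finset.prod_filter, dotProduct, sgn_sum]
  refine Finset.prod_congr rfl fun i _ => ?_
  rcases zmod_two_cases (γ i) with h | h <;> cases hx : x i <;>
    simp [h, hx, cubeEquiv, signv, sgn_zero, sgn_one]

lemma prod_signv_eq_sgn (S : Finset (Fin n)) (x : Fin n → Bool) :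
    ∏ i ∈ S, signv (x i) = sgn (indicatorVec S ⬝ᵥ (cubeEquiv n).symm x) := by
  rw [← chiVal_eq_sgn, chiVal]
  refine Finset.prod_congr ?_ fun _ _ => rfl
  ext i
  simp [indicatorVec]

lemma fourierCoeff_eq_hat (f : (Fin n → Bool) → ℝ) (S : Finset (Fin n)) :
    fourierCoeff f S = hat (f ∘ cubeEquiv n) (indicatorVec S) := by
  rw [fourierCoeff, hat, ← Equiv.sum_comp (cubeEquiv n)]
  simp only [prod_signv_eq_sgn, Equiv.symm_apply_apply, Function.comp_apply]

lemma indicatorVec_bijective : Function.Bijective (indicatorVec (n := n)) := by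
  refine ⟨fun S T h => ?_, fun v => ⟨Finset.univ.filter fun i => v i = 1, ?_⟩⟩
  · ext i
    have hi := congrFun h i
    by_cases hS : i ∈ S <;> by_cases hT : i ∈ T <;> simp_all [indicatorVec]
  · funext i
    rcases zmod_two_cases (v i) with h | h <;> simp [indicatorVec, h]

lemma image_fourierSupport (f : (Fin n → Bool) → ℝ) :
    (fourierSupport f).image indicatorVec = hatSupport (f ∘ cubeEquiv n) := by
  ext γ
  obtain ⟨S, rfl⟩ := indicatorVec_bijective.2 γ
  rw [indicatorVec_bijective.1.mem_finset_image]
  simp [fourierSupport, hatSupport, fourierCoeff_eq_hat]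

lemma sparsity_eq_card_hatSupport (f : (Fin n → Bool) → ℝ) :
    sparsity f = (hatSupport (f ∘ cubeEquiv n)).card := by
  rw [← image_fourierSupport, Finset.card_image_of_injective _ indicatorVec_bijective.1, sparsity]

lemma numClasses_eq_card_image (f : (Fin n → Bool) → ℝ) (Γ : Finset (Fin n → ZMod 2)) :
    numClasses f Γ = ((hatSupport (f ∘ cubeEquiv n)).image (parityClass Γ)).card := by
  rw [← image_fourierSupport, Finset.image_image]
  rfl

lemma weight_eq (f : (Fin n → Bool) → ℝ) :
    weight f =
      ((Finset.univ.filter fun v => (f ∘ cubeEquiv n) v = -1).card : ℝ) / 2 ^ n := by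
  rw [weight]
  congr 2
  exact (Finset.card_equiv (cubeEquiv n) (by simp)).symm

lemma toZ2_eq (e : (Fin m → Bool) → (Fin n → Bool)) (v : Fin m → ZMod 2) :
    toZ2 e v = (cubeEquiv n).symm (e (cubeEquiv m v)) := rfl

lemma chiVal_eq_chiVal_iff (Γ : Finset (Fin n → ZMod 2)) (v w : Fin n → ZMod 2) :
    (∀ γ ∈ Γ, chiVal γ (cubeEquiv n v) = chiVal γ (cubeEquiv n w)) ↔ v + w ∈ orth Γ := by
  simp only [chiVal_eq_sgn, Equiv.symm_apply_apply, sgn_injective.eq_iff, mem_orth,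
    ← vec_sub_eq_add, dotProduct_sub, sub_eq_zero]

lemma card_filter_coset (Γ : Finset (Fin n → ZMod 2)) (v : Fin n → ZMod 2)
    (p : (Fin n → Bool) → Prop) :
    (Finset.univ.filter fun x : Fin n → Bool =>
      (∀ γ ∈ Γ, chiVal γ x = chiVal γ (cubeEquiv n v)) ∧ p x).card =
    (Finset.univ.filter fun y : orth Γ => p (cubeEquiv n (v + y))).card := by
  symm
  refine Finset.card_bij (fun y _ => cubeEquiv n (v + y)) (fun y hy => ?_)
    (fun y _ z _ h => ?_) fun x hx => ?_
  · refine Finset.mem_filter.mpr ⟨Finset.mem_univ _, ?_, (Finset.mem_filter.mp hy).2⟩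
    rw [chiVal_eq_chiVal_iff, add_right_comm, vec_add_self, zero_add]
    exact y.2
  · exact Subtype.ext (add_left_cancel ((cubeEquiv n).injective h))
  · obtain ⟨w, rfl⟩ := (cubeEquiv n).surjective x
    obtain ⟨-, hw, hp⟩ := Finset.mem_filter.mp hx
    rw [chiVal_eq_chiVal_iff] at hw
    have hvw : v + (w + v) = w := by rw [add_left_comm, vec_add_self, add_zero]
    refine ⟨⟨w + v, hw⟩, Finset.mem_filter.mpr ⟨Finset.mem_univ _, ?_⟩, ?_⟩
    · simpa only [hvw] using hp
    · simp only [hvw]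

lemma restrWeight_eq_cosetWeight (f : (Fin n → Bool) → ℝ) (Γ : Finset (Fin n → ZMod 2))
    (v : Fin n → ZMod 2) :
    restrWeight f {x | ∀ γ ∈ Γ, chiVal γ x = chiVal γ (cubeEquiv n v)} =
      cosetWeight (f ∘ cubeEquiv n) Γ v := by
  have h := card_filter_coset Γ v fun _ => True
  simp only [and_true, Finset.filter_true, Finset.card_univ] at h
  rw [restrWeight, cosetWeight]
  simp only [Set.mem_ofPred_eq, Function.comp_apply]
  rw [h, card_filter_coset]

end

/-- **Main restriction lemma.** Let `Γ` be a linearly independent finite set of nonzero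
parities, and let `ℓ ≥ 2` be the number of equivalence classes of `supp(f)` under
`γ₁ ≡ γ₂ ↔ γ₁ + γ₂ ∈ span(Γ)`.  Then there is an assignment `b ∈ {-1,1}^Γ` such that
the restriction of `f` to `V_b = {x : χ_γ(x) = b_γ ∀γ ∈ Γ}` is non-constant and, for
every identification `e` of `{-1,1}^{n-|Γ|}` with `V_b` by an invertible affine
(`F₂`-affine, i.e. `e(u+v+w) = e(u)+e(v)+e(w)` in `F₂`-coordinates) transformation,
`δ(f|_{V_b}) / k(f ∘ e) ≤ 4·k(f)·δ(f)/ℓ²`. -/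
theorem restriction_weight_sparsity_ratio
    (n : ℕ) (f : (Fin n → Bool) → ℝ) (hf : IsBooleanFunc f)
    (Γ : Finset (Fin n → ZMod 2)) (hΓ0 : (0 : Fin n → ZMod 2) ∉ Γ)
    (hΓli : LinearIndependent (ZMod 2)
      (fun γ : {v : Fin n → ZMod 2 // v ∈ Γ} => (γ : Fin n → ZMod 2)))
    (hl : 2 ≤ numClasses f Γ) :
    ∃ b : (Fin n → ZMod 2) → ℝ,
      (∀ γ ∈ Γ, b γ = 1 ∨ b γ = -1) ∧
      (∃ x, (∀ γ ∈ Γ, chiVal γ x = b γ) ∧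
        ∃ y, (∀ γ ∈ Γ, chiVal γ y = b γ) ∧ f x ≠ f y) ∧
      ∀ e : (Fin (n - Γ.card) → Bool) → (Fin n → Bool),
        Function.Injective e →
        Set.range e = {x | ∀ γ ∈ Γ, chiVal γ x = b γ} →
        (∀ u v w : Fin (n - Γ.card) → ZMod 2,
          toZ2 e (u + v + w) = toZ2 e u + toZ2 e v + toZ2 e w) →
        restrWeight f {x | ∀ γ ∈ Γ, chiVal γ x = b γ} / (sparsity (f ∘ e) : ℝ) ≤
          4 * (sparsity f : ℝ) * weight f / (numClasses f Γ : ℝ) ^ 2 := by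
  rw [numClasses_eq_card_image] at hl
  obtain ⟨v, hpos, hle⟩ := exists_cosetWeight_le (f ∘ cubeEquiv n) Γ hl
  rw [← weight_eq, ← numClasses_eq_card_image, ← sparsity_eq_card_hatSupport] at hle
  refine ⟨fun γ => chiVal γ (cubeEquiv n v), fun γ _ => ?_, ?_, fun e hinj hrange he => ?_⟩
  · simp only [chiVal_eq_sgn, Equiv.symm_apply_apply]
    rcases zmod_two_cases (γ ⬝ᵥ v) with h | h <;>
      simp [h, sgn_zero, sgn_one]
  · obtain ⟨y, hy⟩ := exists_ne_on_coset hpos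
    refine ⟨cubeEquiv n v, fun _ _ => rfl, cubeEquiv n (v + y), ?_, hy⟩
    rw [chiVal_eq_chiVal_iff, add_right_comm, vec_add_self, zero_add]
    exact y.2
  · have hcard := card_activeClasses_le (f ∘ cubeEquiv n) Γ v (e := toZ2 e)
      (fun u w h => (cubeEquiv _).injective (hinj ((cubeEquiv n).symm.injective h)))
      (fun w => by
        rw [← chiVal_eq_chiVal_iff]
        have hw := Set.ext_iff.mp hrange (cubeEquiv n w)
        rw [Set.mem_ofPred_eq] at hw
        rw [← hw]
        constructor
        · rintro ⟨u, rfl⟩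
          exact ⟨cubeEquiv _ u, by rw [toZ2_eq, Equiv.apply_symm_apply]⟩
        · rintro ⟨x, hx⟩
          exact ⟨(cubeEquiv _).symm x, by
            rw [toZ2_eq, Equiv.apply_symm_apply, hx, Equiv.symm_apply_apply]⟩) he
    have hcomp : (f ∘ cubeEquiv n) ∘ toZ2 e = (f ∘ e) ∘ cubeEquiv _ := by
      funext u
      simp only [Function.comp_apply, toZ2_eq, Equiv.apply_symm_apply]
    rw [hcomp, ← sparsity_eq_card_hatSupport] at hcard
    have hs : (0 : ℝ) < sparsity (f ∘ e) := by exact_mod_cast hpos.trans_le hcard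
    rw [restrWeight_eq_cosetWeight, div_le_iff₀ hs]
    refine hle.trans ?_
    have hw : 0 ≤ weight f := by
      rw [weight]
      positivity
    gcongr

end BoolFunc

end
end
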